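/- arXiv:2204.13297 — 2 statements merged into one kernel-verified Lean document; each statement's English description precedes it below -/
import Mathlib

section
/- MLR is not linearly Medvedev reducible to Either(MLR): there is no linear reduction Φ such that Φ^X ∈ MLR for every X ∈ Either(MLR). In symbols, MLR ≰_{s,ℓ} Either(MLR). -/
open MeasureTheory

/-- Cantor space `2^ω`: functions from `ℕ` to `Bool`. -/
abbrev Cantor : Type := ℕ → Bool

/-- The fair-coin product measure on Cantor space (each bit is `true` with probability 1/2,
independently), realized concretely as the pushforward of Lebesgue measure on `[0,1)`
under the binary-digit map `x ↦ (n ↦ n-th binary digit of x)`. -/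
noncomputable def fairCoin : Measure Cantor :=
  Measure.map (fun (x : ℝ) (n : ℕ) => decide ((⌊x * 2 ^ (n + 1)⌋ % 2 : ℤ) = 1))
    (volume.restrict (Set.Ico (0 : ℝ) 1))

/-- The cylinder `[σ]` of all `X ∈ 2^ω` extending the finite binary string `σ`. -/
def cylinder (σ : List Bool) : Set Cantor :=
  {X | ∀ (i : ℕ) (h : i < σ.length), X i = σ.get ⟨i, h⟩}

/-- The `n`-th level `U_n` of a test `U`: the union of the cylinders enumerated by `U n`. -/
def testSet (U : ℕ → ℕ → Option (List Bool)) (n : ℕ) : Set Cantor :=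
  ⋃ σ ∈ {σ : List Bool | ∃ k, U n k = some σ}, cylinder σ

/-- A Martin-Löf test: a computable enumeration of cylinders with `μ(U_n) ≤ 2^{-n}`. -/
def MLTest (U : ℕ → ℕ → Option (List Bool)) : Prop :=
  Computable₂ U ∧ ∀ n, fairCoin (testSet U n) ≤ ((2 : ENNReal) ^ n)⁻¹

/-- The Martin-Löf random elements of Cantor space. -/
def MLR : Set Cantor :=
  {X | ∀ U : ℕ → ℕ → Option (List Bool), MLTest U → ∃ n, X ∉ testSet U n}

/-- The computability-theoretic join: `(A ⊕ B)(2k) = A(k)` and `(A ⊕ B)(2k+1) = B(k)`. -/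
def join (A B : Cantor) : Cantor := fun n => if n % 2 = 0 then A (n / 2) else B (n / 2)

/-- `Either(C) = {A ⊕ B : A ∈ C or B ∈ C}`. -/
def Either (C : Set Cantor) : Set Cantor :=
  {Z | ∃ A B : Cantor, Z = join A B ∧ (A ∈ C ∨ B ∈ C)}

/-- The output `Φ^X` of the linear reduction given by query positions `q n` (distinct) and
constants `b n`: `Φ^X(n) = b n + Σ_{i ∈ q n} X(i)` with addition mod 2 (XOR). -/
def linEval (q : ℕ → List ℕ) (b : ℕ → Bool) (X : Cantor) : Cantor :=
  fun n => (q n).foldl (fun acc i => xor acc (X i)) (b n)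

/-! ### The fair-coin measure -/

/-- The binary digit map. -/
noncomputable def digitMap (x : ℝ) : Cantor :=
  fun n => decide ((⌊x * 2 ^ (n + 1)⌋ % 2 : ℤ) = 1)

lemma measurable_digitMap : Measurable digitMap := by
  refine measurable_pi_lambda _ fun n => ?_
  have h1 : Measurable (fun x : ℝ => ⌊x * 2 ^ (n + 1)⌋) :=
    Int.measurable_floor.comp (measurable_id.mul_const _)
  exact (measurable_from_top (f := fun z : ℤ => decide (z % 2 = 1))).comp h1

lemma fairCoin_apply {S : Set Cantor} (hS : MeasurableSet S) :
    fairCoin S = volume (digitMap ⁻¹' S ∩ Set.Ico (0 : ℝ) 1) := by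
  have h : fairCoin = Measure.map digitMap (volume.restrict (Set.Ico (0 : ℝ) 1)) := rfl
  rw [h, Measure.map_apply measurable_digitMap hS,
    Measure.restrict_apply (measurable_digitMap hS)]

lemma fairCoin_univ : fairCoin Set.univ = 1 := by
  rw [fairCoin_apply MeasurableSet.univ]
  simp

/-- Flipping digit `n` from `0` to `1` by translation. -/
lemma digitMap_add (x : ℝ) (n : ℕ) (h : digitMap x n = false) :
    digitMap (x + ((2 : ℝ) ^ (n + 1))⁻¹) = Function.update (digitMap x) n true := by
  have he : ⌊x * 2 ^ (n + 1)⌋ % 2 = 0 := by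
    simp [digitMap] at h
    omega
  funext j
  rcases lt_trichotomy j n with hj | hj | hj
  · rw [Function.update_of_ne hj.ne]
    have key : ∀ y : ℝ, ⌊y * 2 ^ (j + 1)⌋ = ⌊y * 2 ^ (n + 1)⌋ / ((2 ^ (n - j) : ℕ) : ℤ) := by
      intro y
      rw [← Int.floor_div_natCast]
      congr 1
      have : (2 : ℝ) ^ (n + 1) = 2 ^ (j + 1) * 2 ^ (n - j) := by
        rw [← pow_add]; congr 1; omega
      rw [this]
      push_cast
      field_simp
    have e2 : ⌊(x + ((2 : ℝ) ^ (n + 1))⁻¹) * 2 ^ (n + 1)⌋ = ⌊x * 2 ^ (n + 1)⌋ + 1 := by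
      rw [add_mul, inv_mul_cancel₀ (by positivity), Int.floor_add_one]
    unfold digitMap
    rw [key, key, e2]
    have : ((2 ^ (n - j) : ℕ) : ℤ) = 2 * 2 ^ (n - j - 1) := by
      rw [← pow_succ']; push_cast; congr 1; omega
    rw [this, ← Int.ediv_ediv_of_nonneg (by norm_num), ← Int.ediv_ediv_of_nonneg (by norm_num)]
    have : (⌊x * 2 ^ (n + 1)⌋ + 1) / 2 = ⌊x * 2 ^ (n + 1)⌋ / 2 := by omega
    rw [this]
  · subst hj
    have e2 : ⌊(x + ((2 : ℝ) ^ (j + 1))⁻¹) * 2 ^ (j + 1)⌋ = ⌊x * 2 ^ (j + 1)⌋ + 1 := by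
      rw [add_mul, inv_mul_cancel₀ (by positivity), Int.floor_add_one]
    simp only [digitMap, e2, Function.update_self, decide_eq_true_eq]
    omega
  · rw [Function.update_of_ne hj.ne']
    have e2 : ⌊(x + ((2 : ℝ) ^ (n + 1))⁻¹) * 2 ^ (j + 1)⌋
        = ⌊x * 2 ^ (j + 1)⌋ + 2 * 2 ^ (j - n - 1) := by
      have : (2 : ℝ) ^ (j + 1) = 2 ^ (n + 1) * (2 * 2 ^ (j - n - 1)) := by
        rw [← pow_succ', ← pow_add]; congr 1; omega
      have h3 : (x + ((2 : ℝ) ^ (n + 1))⁻¹) * 2 ^ (j + 1)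
          = x * 2 ^ (j + 1) + ((2 * 2 ^ (j - n - 1) : ℤ) : ℝ) := by
        rw [add_mul]
        congr 1
        rw [this]
        push_cast
        field_simp
      rw [h3, Int.floor_add_intCast]
    simp only [digitMap, e2]
    congr 1
    simp [Int.add_mul_emod_self_left]

lemma digit_add_mem (x : ℝ) (n : ℕ) (hx : x ∈ Set.Ico (0 : ℝ) 1) (h : digitMap x n = false) :
    x + ((2 : ℝ) ^ (n + 1))⁻¹ ∈ Set.Ico (0 : ℝ) 1 := by
  have he : ⌊x * 2 ^ (n + 1)⌋ % 2 = 0 := by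
    simp [digitMap] at h
    omega
  have hp : (0 : ℝ) < 2 ^ (n + 1) := by positivity
  refine ⟨add_nonneg hx.1 (by positivity), ?_⟩
  have h1 : ⌊x * 2 ^ (n + 1)⌋ < 2 * 2 ^ n := by
    rw [Int.floor_lt]
    push_cast
    rw [← pow_succ']
    nlinarith [hx.2]
  have h2 : ⌊x * 2 ^ (n + 1)⌋ + 2 ≤ 2 * 2 ^ n := by omega
  have h3 : ((⌊x * 2 ^ (n + 1)⌋ : ℝ)) + 2 ≤ 2 ^ (n + 1) := by
    have : ((⌊x * 2 ^ (n + 1)⌋ : ℝ)) + 2 ≤ 2 * 2 ^ n := by exact_mod_cast h2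
    rwa [← pow_succ'] at this
  have h4 := Int.lt_floor_add_one (x * 2 ^ (n + 1))
  have h5 : (x + ((2 : ℝ) ^ (n + 1))⁻¹) * 2 ^ (n + 1) < 1 * 2 ^ (n + 1) := by
    rw [add_mul, inv_mul_cancel₀ hp.ne']
    linarith
  exact lt_of_mul_lt_mul_right h5 hp.le

/-- If `S` does not depend on bit `n`, half of `S` has bit `n` equal to `c`. -/
lemma fairCoin_half {S : Set Cantor} (hS : MeasurableSet S) (n : ℕ)
    (hinv : ∀ X v, X ∈ S → Function.update X n v ∈ S) (c : Bool) :
    2 * fairCoin (S ∩ {X | X n = c}) = fairCoin S := by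
  have hm : ∀ c : Bool, MeasurableSet {X : Cantor | X n = c} := fun c =>
    measurableSet_eq_fun (measurable_pi_apply n) measurable_const
  have heq : fairCoin (S ∩ {X | X n = false}) = fairCoin (S ∩ {X | X n = true}) := by
    rw [fairCoin_apply (hS.inter (hm _)), fairCoin_apply (hS.inter (hm _))]
    set d : ℝ := ((2 : ℝ) ^ (n + 1))⁻¹ with hd
    apply le_antisymm
    · rw [← measure_preimage_add_right volume d
        (digitMap ⁻¹' (S ∩ {X | X n = true}) ∩ Set.Ico (0 : ℝ) 1)]
      apply measure_mono
      rintro x ⟨⟨hxS, hxn⟩, hx⟩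
      have hxn : digitMap x n = false := hxn
      refine ⟨?_, digit_add_mem x n hx hxn⟩
      show digitMap (x + d) ∈ S ∩ {X | X n = true}
      rw [hd, digitMap_add x n hxn]
      exact ⟨hinv _ _ hxS, by simp⟩
    · rw [← measure_preimage_add_right volume (-d)
        (digitMap ⁻¹' (S ∩ {X | X n = false}) ∩ Set.Ico (0 : ℝ) 1)]
      apply measure_mono
      rintro x ⟨⟨hxS, hxn⟩, hx⟩
      have hp : (0 : ℝ) < 2 ^ (n + 1) := by positivity
      have hxn : digitMap x n = true := hxn
      have hod : ⌊x * 2 ^ (n + 1)⌋ % 2 = 1 := by simpa [digitMap] using hxn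
      have hfl : ⌊(x + -d) * 2 ^ (n + 1)⌋ = ⌊x * 2 ^ (n + 1)⌋ - 1 := by
        rw [add_mul, neg_mul, hd, inv_mul_cancel₀ hp.ne', ← sub_eq_add_neg, Int.floor_sub_one]
      have hf : digitMap (x + -d) n = false := by
        simp only [digitMap, hfl, decide_eq_false_iff_not]
        omega
      have hb := digitMap_add (x + -d) n hf
      rw [← hd, neg_add_cancel_right] at hb
      have hS' : digitMap (x + -d) ∈ S := by
        have := hinv _ false hxS
        rw [hb, Function.update_idem] at this
        rwa [← hf, Function.update_eq_self] at this
      refine ⟨⟨hS', hf⟩, ?_, ?_⟩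
      · have h0 : 0 ≤ ⌊x * 2 ^ (n + 1)⌋ := Int.floor_nonneg.2 (mul_nonneg hx.1 hp.le)
        have h1 : 0 ≤ ⌊(x + -d) * 2 ^ (n + 1)⌋ := by omega
        exact nonneg_of_mul_nonneg_left (Int.floor_nonneg.1 h1) hp
      · have : 0 < d := by positivity
        linarith [hx.2]
  have hsum : fairCoin (S ∩ {X | X n = false}) + fairCoin (S ∩ {X | X n = true})
      = fairCoin S := by
    rw [← measure_inter_add_sdiff S (hm false)]
    congr 2
    ext X
    simp
  cases c
  · rw [two_mul]; nth_rewrite 2 [heq]; exact hsum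
  · rw [two_mul]; nth_rewrite 1 [← heq]; exact hsum

lemma measurableSet_constraint (n : ℕ → ℕ) (c : ℕ → Bool) (m : ℕ) :
    MeasurableSet {X : Cantor | ∀ j < m, X (n j) = c j} := by
  have : {X : Cantor | ∀ j < m, X (n j) = c j} = ⋂ j, ⋂ (_ : j < m), {X | X (n j) = c j} := by
    ext X; simp
  rw [this]
  exact MeasurableSet.iInter fun j => MeasurableSet.iInter fun _ =>
    measurableSet_eq_fun (measurable_pi_apply (n j)) measurable_const

lemma fairCoin_constraint (n : ℕ → ℕ) (hn : Function.Injective n) (c : ℕ → Bool) (m : ℕ) :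
    fairCoin {X : Cantor | ∀ j < m, X (n j) = c j} = ((2 : ENNReal) ^ m)⁻¹ := by
  induction m with
  | zero => simpa using fairCoin_univ
  | succ m ih =>
    have hset : {X : Cantor | ∀ j < m + 1, X (n j) = c j}
        = {X : Cantor | ∀ j < m, X (n j) = c j} ∩ {X | X (n m) = c m} := by
      ext X
      simp only [Set.mem_ofPred_eq, Set.mem_inter_iff]
      exact Nat.forall_lt_succ_right
    have h := fairCoin_half (measurableSet_constraint n c m) (n m) (by
      intro X v hX j hj
      rw [Function.update_of_ne (fun h => hj.ne (hn h))]
      exact hX j hj) (c m)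
    rw [← hset, ih] at h
    rw [pow_succ, ENNReal.mul_inv (by simp) (by simp), ← h, mul_comm 2, mul_assoc,
      ENNReal.mul_inv_cancel (by simp) (by simp), mul_one]

/-! ### A family of tests -/

/-- check that `σ` satisfies the first `m` constraints -/
def chk (n : ℕ → ℕ) (c : ℕ → Bool) (σ : List Bool) (m : ℕ) : Bool :=
  Nat.rec true (fun j acc => acc && decide (σ[n j]? = some (c j))) m

lemma chk_iff (n : ℕ → ℕ) (c : ℕ → Bool) (σ : List Bool) (m : ℕ) :
    chk n c σ m = true ↔ ∀ j < m, σ[n j]? = some (c j) := by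
  induction m with
  | zero => simp [chk]
  | succ m ih =>
    rw [Nat.forall_lt_succ_right, ← ih]
    simp [chk]

/-- the test capturing the constraints -/
def conTest (n : ℕ → ℕ) (c : ℕ → Bool) (m k : ℕ) : Option (List Bool) :=
  (Encodable.decode (α := List Bool) k).bind fun σ => bif chk n c σ m then some σ else none

lemma conTest_eq (n : ℕ → ℕ) (c : ℕ → Bool) (m k : ℕ) (σ : List Bool) :
    conTest n c m k = some σ ↔
      Encodable.decode (α := List Bool) k = some σ ∧ chk n c σ m = true := by
  unfold conTest
  cases h : Encodable.decode (α := List Bool) k with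
  | none => simp
  | some τ =>
    cases h2 : chk n c τ m
    · simp [h2]; rintro rfl; exact h2
    · simp [h2]; rintro rfl; exact h2

lemma computable_chk {n : ℕ → ℕ} {c : ℕ → Bool} (hn : Computable n) (hc : Computable c) :
    Computable (fun p : List Bool × ℕ => chk n c p.1 p.2) := by
  unfold chk
  refine Computable.nat_rec (f := fun p : List Bool × ℕ => p.2) (g := fun _ => true)
    (h := fun (p : List Bool × ℕ) (jb : ℕ × Bool) =>
      jb.2 && decide (p.1[n jb.1]? = some (c jb.1)))
    Computable.snd (Computable.const true) ?_
  have hj : Computable (fun z : (List Bool × ℕ) × (ℕ × Bool) => z.2.1) :=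
    Computable.fst.comp Computable.snd
  have hacc : Computable (fun z : (List Bool × ℕ) × (ℕ × Bool) => z.2.2) :=
    Computable.snd.comp Computable.snd
  have hσ : Computable (fun z : (List Bool × ℕ) × (ℕ × Bool) => z.1.1) :=
    Computable.fst.comp Computable.fst
  have hget : Computable (fun z : (List Bool × ℕ) × (ℕ × Bool) => z.1.1[n z.2.1]?) :=
    (Primrec.list_getElem?.to_comp).comp hσ (hn.comp hj)
  have hsome : Computable (fun z : (List Bool × ℕ) × (ℕ × Bool) => some (c z.2.1)) :=
    Computable.option_some.comp (hc.comp hj)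
  have heq : Computable₂ (fun a b : Option Bool => decide (a = b)) :=
    (Primrec.eq (α := Option Bool)).decide.to_comp
  exact (Primrec.and.to_comp).comp hacc (heq.comp hget hsome)

lemma computable_conTest {n : ℕ → ℕ} {c : ℕ → Bool} (hn : Computable n) (hc : Computable c) :
    Computable₂ (conTest n c) := by
  have h1 : Computable (fun z : (ℕ × ℕ) × List Bool => chk n c z.2 z.1.1) :=
    Computable.comp (f := fun p : List Bool × ℕ => chk n c p.1 p.2)
      (g := fun z : (ℕ × ℕ) × List Bool => (z.2, z.1.1)) (computable_chk hn hc)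
      (Computable.pair Computable.snd (Computable.fst.comp Computable.fst))
  have h2 : Computable (fun z : (ℕ × ℕ) × List Bool =>
      bif chk n c z.2 z.1.1 then some z.2 else none) :=
    Computable.cond h1 (Computable.option_some.comp Computable.snd) (Computable.const none)
  have h3 : Computable (fun p : ℕ × ℕ => Encodable.decode (α := List Bool) p.2) :=
    Computable.decode.comp Computable.snd
  have h4 : Computable (fun p : ℕ × ℕ => (Encodable.decode (α := List Bool) p.2).bind
      ((fun (p : ℕ × ℕ) (σ : List Bool) => bif chk n c σ p.1 then some σ else none) p)) :=
    Computable.option_bind h3 h2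
  exact h4

lemma testSet_conTest (n : ℕ → ℕ) (c : ℕ → Bool) (m : ℕ) :
    testSet (conTest n c) m = {X : Cantor | ∀ j < m, X (n j) = c j} := by
  ext X
  simp only [testSet, Set.mem_iUnion, Set.mem_ofPred_eq, exists_prop]
  constructor
  · rintro ⟨σ, ⟨k, hk⟩, hX⟩ j hj
    rw [conTest_eq, chk_iff] at hk
    have h := hk.2 j hj
    rw [List.getElem?_eq_some_iff] at h
    obtain ⟨hl, h⟩ := h
    rw [← h]
    exact hX (n j) hl
  · intro hX
    obtain ⟨N, hN⟩ : ∃ N, ∀ j < m, n j < N := by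
      refine ⟨(Finset.range m).sup n + 1, fun j hj => Nat.lt_succ_of_le ?_⟩
      exact Finset.le_sup (f := n) (Finset.mem_range.2 hj)
    refine ⟨(List.range N).map X, ⟨Encodable.encode ((List.range N).map X), ?_⟩, ?_⟩
    · rw [conTest_eq, chk_iff]
      refine ⟨Encodable.encodek _, fun j hj => ?_⟩
      simp [hN j hj, hX j hj]
    · intro i hi
      simp

lemma not_mlr_of_constraints {n : ℕ → ℕ} {c : ℕ → Bool} (hn : Computable n) (hc : Computable c)
    (hinj : Function.Injective n) {Y : Cantor} (hY : ∀ k, Y (n k) = c k) : Y ∉ MLR := by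
  intro h
  obtain ⟨m, hm⟩ := h (conTest n c)
    ⟨computable_conTest hn hc, fun m => by rw [testSet_conTest, fairCoin_constraint n hinj]⟩
  rw [testSet_conTest] at hm
  exact hm fun j _ => hY j

/-! ### Existence of a random -/

lemma countable_tests : {U : ℕ → ℕ → Option (List Bool) | Computable₂ U}.Countable := by
  have hex : ∀ U : {U : ℕ → ℕ → Option (List Bool) | Computable₂ U},
      ∃ c : Nat.Partrec.Code, ∀ a : ℕ × ℕ,
        c.eval (Encodable.encode a) = Part.some (Encodable.encode (U.1 a.1 a.2)) := by
    rintro ⟨U, hU⟩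
    have h : Nat.Partrec fun n => Part.bind (Encodable.decode (α := ℕ × ℕ) n)
      fun a => ((fun p : ℕ × ℕ => (U p.1 p.2 : Part (Option (List Bool)))) a).map
        Encodable.encode := hU
    obtain ⟨c, hc⟩ := Nat.Partrec.Code.exists_code.1 h
    refine ⟨c, fun a => ?_⟩
    rw [hc]
    simp only [Encodable.encodek, Part.coe_some, Part.bind_some]
    exact Part.map_some _ _
  choose f hf using hex
  have hinj : Function.Injective f := by
    intro U V h
    apply Subtype.ext
    funext m k
    have h1 := hf U (m, k)
    rw [h, hf V (m, k)] at h1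
    exact (Encodable.encode_injective (Part.some_injective h1)).symm
  exact Set.countable_coe_iff.1 hinj.countable

lemma exists_mlr : ∃ R, R ∈ MLR := by
  by_contra hno
  push Not at hno
  have hc : {U : ℕ → ℕ → Option (List Bool) | MLTest U}.Countable :=
    countable_tests.mono fun U hU => hU.1
  have hnull : fairCoin (⋃ U ∈ {U : ℕ → ℕ → Option (List Bool) | MLTest U},
      ⋂ n, testSet U n) = 0 := by
    rw [measure_biUnion_null_iff hc]
    intro U hU
    refine le_antisymm (ENNReal.le_of_forall_pos_le_add ?_) (zero_le)
    intro ε hε _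
    obtain ⟨n, hn⟩ := ENNReal.exists_inv_two_pow_lt (a := (ε : ENNReal)) (by
      simpa using hε.ne')
    calc fairCoin (⋂ n, testSet U n) ≤ fairCoin (testSet U n) :=
          measure_mono (Set.iInter_subset _ n)
      _ ≤ ((2 : ENNReal) ^ n)⁻¹ := hU.2 n
      _ ≤ 0 + ε := by rw [zero_add, ENNReal.inv_pow]; exact hn.le
  have huniv : (⋃ U ∈ {U : ℕ → ℕ → Option (List Bool) | MLTest U},
      ⋂ n, testSet U n) = Set.univ := by
    apply Set.eq_univ_of_forall
    intro X
    have hX := hno X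
    simp only [MLR, Set.mem_ofPred_eq, not_forall, not_exists, not_not] at hX
    obtain ⟨U, hU, hX⟩ := hX
    simp only [Set.mem_iUnion, Set.mem_iInter]
    exact ⟨U, hU, hX⟩
  rw [huniv, fairCoin_univ] at hnull
  exact one_ne_zero hnull

/-! ### Linear evaluation -/

lemma foldl_congr (l : List ℕ) (X Y : Cantor) (h : ∀ i ∈ l, X i = Y i) (a : Bool) :
    l.foldl (fun acc i => xor acc (X i)) a = l.foldl (fun acc i => xor acc (Y i)) a := by
  induction l generalizing a with
  | nil => rfl
  | cons x l ih =>
    simp only [List.foldl_cons]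
    rw [h x (by simp)]
    exact ih (fun i hi => h i (by simp [hi])) _

lemma foldl_not (l : List ℕ) (X : Cantor) (a : Bool) :
    l.foldl (fun acc i => xor acc (X i)) (!a) = !(l.foldl (fun acc i => xor acc (X i)) a) := by
  induction l generalizing a with
  | nil => rfl
  | cons x l ih =>
    simp only [List.foldl_cons]
    rw [← ih]
    simp

lemma foldl_flip (l : List ℕ) (hl : l.Nodup) (X : Cantor) (p : ℕ) (hp : p ∈ l) (a : Bool) :
    l.foldl (fun acc i => xor acc (Function.update X p (!X p) i)) a
      = !(l.foldl (fun acc i => xor acc (X i)) a) := by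
  induction l generalizing a with
  | nil => simp at hp
  | cons x l ih =>
    rw [List.nodup_cons] at hl
    simp only [List.foldl_cons]
    by_cases hx : x = p
    · subst hx
      have hb : ∀ u v : Bool, xor u (!v) = !(xor u v) := by decide
      rw [← foldl_not, Function.update_self, hb]
      apply foldl_congr
      intro i hi
      rw [Function.update_of_ne]
      rintro rfl
      exact hl.1 hi
    · rw [Function.update_of_ne hx]
      exact ih hl.2 (by simpa [Ne.symm hx] using hp) _

/-! ### The unbounded case -/

/-- does the list contain an element `≥ s` of parity `r`? -/
def hasBig (r s : ℕ) (l : List ℕ) : Bool :=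
  l.foldl (fun acc i => acc || (decide (s ≤ i) && decide (i % 2 = r))) false

lemma hasBig_aux (r s : ℕ) (l : List ℕ) (a : Bool) :
    l.foldl (fun acc i => acc || (decide (s ≤ i) && decide (i % 2 = r))) a = true ↔
      a = true ∨ ∃ i ∈ l, s ≤ i ∧ i % 2 = r := by
  induction l generalizing a with
  | nil => simp
  | cons x l ih =>
    simp only [List.foldl_cons]
    rw [ih]
    simp [or_assoc]

lemma hasBig_iff (r s : ℕ) (l : List ℕ) :
    hasBig r s l = true ↔ ∃ i ∈ l, s ≤ i ∧ i % 2 = r := by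
  unfold hasBig
  rw [hasBig_aux]
  simp

lemma primrec_hasBig (r : ℕ) : Primrec₂ (hasBig r) := by
  unfold hasBig
  refine Primrec.list_foldl (f := fun p : ℕ × List ℕ => p.2) (g := fun _ => false)
    (h := fun (p : ℕ × List ℕ) (z : Bool × ℕ) =>
      z.1 || (decide (p.1 ≤ z.2) && decide (z.2 % 2 = r)))
    Primrec.snd (Primrec.const false) ?_
  have hi : Primrec (fun z : (ℕ × List ℕ) × (Bool × ℕ) => z.2.2) :=
    Primrec.snd.comp Primrec.snd
  have hle : Primrec (fun z : (ℕ × List ℕ) × (Bool × ℕ) => decide (z.1.1 ≤ z.2.2)) :=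
    Primrec.nat_le.decide.comp (Primrec.fst.comp Primrec.fst) hi
  have heq : Primrec (fun z : (ℕ × List ℕ) × (Bool × ℕ) => decide (z.2.2 % 2 = r)) :=
    (Primrec.eq (α := ℕ)).decide.comp (Primrec.nat_mod.comp hi (Primrec.const 2))
      (Primrec.const r)
  exact Primrec.or.comp (Primrec.fst.comp Primrec.snd) (Primrec.and.comp hle heq)

/-- strict upper bound of a list -/
def bnd (l : List ℕ) : ℕ := l.foldl (fun acc i => acc + i) 0 + 1

lemma bnd_aux (l : List ℕ) (a : ℕ) :
    a ≤ l.foldl (fun acc i => acc + i) a ∧ ∀ i ∈ l, i ≤ l.foldl (fun acc i => acc + i) a := by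
  induction l generalizing a with
  | nil => simp
  | cons x l ih =>
    simp only [List.foldl_cons, List.mem_cons]
    refine ⟨by have := (ih (a + x)).1; omega, ?_⟩
    rintro i (rfl | hi)
    · have := (ih (a + i)).1; omega
    · exact (ih (a + x)).2 i hi

lemma lt_bnd {l : List ℕ} {i : ℕ} (h : i ∈ l) : i < bnd l :=
  Nat.lt_succ_of_le ((bnd_aux l 0).2 i h)

lemma primrec_bnd : Primrec bnd := by
  unfold bnd
  refine Primrec.succ.comp (Primrec.list_foldl (f := fun l : List ℕ => l) (g := fun _ => 0)
    (h := fun (_ : List ℕ) (z : ℕ × ℕ) => z.1 + z.2) Primrec.id (Primrec.const 0) ?_)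
  exact Primrec.nat_add.comp (Primrec.fst.comp Primrec.snd) (Primrec.snd.comp Primrec.snd)

section unbounded

variable (q : ℕ → List ℕ) (r : ℕ) (hbig : ∀ s, ∃ n, hasBig r s (q n) = true)

/-- first stage whose query list has a large element -/
def nxt (s : ℕ) : ℕ := Nat.find (hbig s)

/-- bounds -/
def sSeq (k : ℕ) : ℕ := Nat.rec 0 (fun _ s => bnd (q (nxt q r hbig s))) k

/-- selected output positions -/
def nSeq (k : ℕ) : ℕ := nxt q r hbig (sSeq q r hbig k)

lemma computable_nxt (hq : Computable q) : Computable (nxt q r hbig) := by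
  have h1 : Computable₂ (fun s n : ℕ => hasBig r s (q n)) :=
    (primrec_hasBig r).to_comp.comp Computable.fst (hq.comp Computable.snd)
  have h2 : Partrec (fun s => Nat.rfind fun n => Part.some (hasBig r s (q n))) :=
    Partrec.rfind h1.partrec₂
  refine h2.of_eq fun s => ?_
  refine Part.eq_some_iff.2 (Nat.mem_rfind.2 ?_)
  refine ⟨?_, ?_⟩
  · have := Nat.find_spec (hbig s)
    simp [nxt, this]
  · intro m hm
    have := Nat.find_min (hbig s) hm
    simpa using this

lemma computable_sSeq (hq : Computable q) : Computable (sSeq q r hbig) := by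
  unfold sSeq
  refine Computable.nat_rec (f := fun k : ℕ => k) (g := fun _ => 0)
    (h := fun (_ : ℕ) (z : ℕ × ℕ) => bnd (q (nxt q r hbig z.2)))
    Computable.id (Computable.const 0) ?_
  exact primrec_bnd.to_comp.comp (hq.comp ((computable_nxt q r hbig hq).comp
    (Computable.snd.comp Computable.snd)))

lemma computable_nSeq (hq : Computable q) : Computable (nSeq q r hbig) :=
  (computable_nxt q r hbig hq).comp (computable_sSeq q r hbig hq)

lemma sSeq_succ (k : ℕ) : sSeq q r hbig (k + 1) = bnd (q (nSeq q r hbig k)) := rfl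

lemma exists_pivot (k : ℕ) :
    ∃ p ∈ q (nSeq q r hbig k), sSeq q r hbig k ≤ p ∧ p % 2 = r :=
  (hasBig_iff _ _ _).1 (Nat.find_spec (hbig (sSeq q r hbig k)))

lemma sSeq_strictMono : StrictMono (sSeq q r hbig) := by
  apply strictMono_nat_of_lt_succ
  intro k
  obtain ⟨p, hp, hs, _⟩ := exists_pivot q r hbig k
  rw [sSeq_succ]
  exact lt_of_le_of_lt hs (lt_bnd hp)

lemma nSeq_injective : Function.Injective (nSeq q r hbig) := by
  have key : ∀ j k, j < k → nSeq q r hbig j ≠ nSeq q r hbig k := by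
    intro j k hjk h
    obtain ⟨p, hp, hs, _⟩ := exists_pivot q r hbig k
    rw [← h] at hp
    have h1 := lt_bnd hp
    rw [← sSeq_succ] at h1
    have h2 := (sSeq_strictMono q r hbig).monotone (show j + 1 ≤ k from hjk)
    omega
  intro j k h
  by_contra hne
  rcases Nat.lt_or_gt_of_ne hne with h1 | h1
  · exact key _ _ h1 h
  · exact key _ _ h1 h.symm

lemma exists_adversary (b : ℕ → Bool) (hnd : ∀ n, (q n).Nodup) (X0 : Cantor) :
    ∃ X : Cantor, (∀ i, i % 2 ≠ r → X i = X0 i) ∧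
      ∀ k, linEval q b X (nSeq q r hbig k) = false := by
  choose p hp hps hpr using exists_pivot q r hbig
  let W : ℕ → Cantor := fun k => Nat.rec X0 (fun k X =>
    if linEval q b X (nSeq q r hbig k) = false then X
    else Function.update X (p k) (!X (p k))) k
  have hW : ∀ k, W (k + 1) = if linEval q b (W k) (nSeq q r hbig k) = false then W k
    else Function.update (W k) (p k) (!W k (p k)) := fun k => rfl
  have hW1 : ∀ k i, i ≠ p k → W (k + 1) i = W k i := by
    intro k i hi
    rw [hW]
    split_ifs
    · rfl
    · rw [Function.update_of_ne hi]
  have hW2 : ∀ k, linEval q b (W (k + 1)) (nSeq q r hbig k) = false := by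
    intro k
    rw [hW]
    split_ifs with h
    · exact h
    · unfold linEval at h ⊢
      rw [foldl_flip _ (hnd _) _ _ (hp k)]
      simpa using h
  have hpar : ∀ k i, i % 2 ≠ r → W k i = X0 i := by
    intro k i hi
    induction k with
    | zero => rfl
    | succ k ih =>
      rw [hW1 k i, ih]
      rintro rfl
      exact hi (hpr k)
  have hmono := sSeq_strictMono q r hbig
  have hstab : ∀ k d i, i < sSeq q r hbig k → W (k + d) i = W k i := by
    intro k d i hi
    induction d with
    | zero => rfl
    | succ d ih =>
      rw [← add_assoc, hW1, ih]
      have h1 := hps (k + d)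
      have h2 := hmono.monotone (show k ≤ k + d by omega)
      omega
  refine ⟨fun i => W (i + 1) i, fun i hi => hpar (i + 1) i hi, fun k => ?_⟩
  rw [← hW2 k]
  apply foldl_congr
  intro i hi
  have h1 : i < sSeq q r hbig (k + 1) := lt_bnd hi
  have h2 : i < sSeq q r hbig (i + 1) := hmono.le_apply (x := i + 1)
  rcases le_total i k with h | h
  · have := hstab (i + 1) (k - i) i h2
    rw [show i + 1 + (k - i) = k + 1 by omega] at this
    exact this.symm
  · have := hstab (k + 1) (i - k) i h1
    rw [show k + 1 + (i - k) = i + 1 by omega] at this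
    exact this

end unbounded

/-! ### The bounded case -/

lemma computable_linEval_bounded {q : ℕ → List ℕ} {b : ℕ → Bool} (hq : Computable q)
    (hb : Computable b) (t : ℕ) (ht : ∀ n, ∀ i ∈ q n, i < t) (X : Cantor) :
    Computable (linEval q b X) := by
  let L : List Bool := (List.range t).map X
  let X' : Cantor := fun i => (L[i]?).getD false
  have hX' : Primrec X' :=
    Primrec.option_getD.comp (Primrec.list_getElem?.comp (Primrec.const L) Primrec.id)
      (Primrec.const false)
  have heq : linEval q b X = linEval q b X' := by
    funext n
    apply foldl_congr
    intro i hi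
    simp [X', L, ht n i hi]
  have hF : Primrec (fun z : List ℕ × Bool => z.1.foldl (fun acc i => xor acc (X' i)) z.2) := by
    refine Primrec.list_foldl (f := fun z : List ℕ × Bool => z.1) (g := fun z => z.2)
      (h := fun (_ : List ℕ × Bool) (w : Bool × ℕ) => xor w.1 (X' w.2))
      Primrec.fst Primrec.snd ?_
    have hx : Primrec₂ (fun a c : Bool => xor a c) := Primrec.dom_finite _
    exact hx.comp (Primrec.fst.comp Primrec.snd) (hX'.comp (Primrec.snd.comp Primrec.snd))
  rw [heq]
  exact hF.to_comp.comp (Computable.pair hq hb)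

lemma mem_either_of_even {X R : Cantor} (hR : R ∈ MLR) (h : ∀ k, X (2 * k) = R k) :
    X ∈ Either MLR := by
  refine ⟨R, fun k => X (2 * k + 1), ?_, Or.inl hR⟩
  funext n
  unfold join
  split_ifs with hn
  · rw [← h]; congr 1; omega
  · show X n = X (2 * (n / 2) + 1)
    congr 1; omega

lemma mem_either_of_odd {X R : Cantor} (hR : R ∈ MLR) (h : ∀ k, X (2 * k + 1) = R k) :
    X ∈ Either MLR := by
  refine ⟨fun k => X (2 * k), R, ?_, Or.inr hR⟩
  funext n
  unfold join
  split_ifs with hn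
  · show X n = X (2 * (n / 2))
    congr 1; omega
  · rw [← h]; congr 1; omega

/-- MLR is not linearly Medvedev reducible to Either(MLR). -/
theorem mlr_not_le_sl_either_mlr :
    ¬ ∃ (q : ℕ → List ℕ) (b : ℕ → Bool),
      Computable q ∧ Computable b ∧ (∀ n, (q n).Nodup) ∧
      ∀ X ∈ Either MLR, linEval q b X ∈ MLR := by
  rintro ⟨q, b, hq, hb, hnd, hred⟩
  obtain ⟨R, hR⟩ := exists_mlr
  by_cases h1 : ∀ s, ∃ n, hasBig 1 s (q n) = true
  · obtain ⟨X, hX, hY⟩ := exists_adversary q 1 h1 b hnd (fun n => R (n / 2))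
    refine not_mlr_of_constraints (computable_nSeq q 1 h1 hq) (Computable.const false)
      (nSeq_injective q 1 h1) hY (hred X (mem_either_of_even hR fun k => ?_))
    rw [hX _ (by omega)]
    congr 1; omega
  by_cases h0 : ∀ s, ∃ n, hasBig 0 s (q n) = true
  · obtain ⟨X, hX, hY⟩ := exists_adversary q 0 h0 b hnd (fun n => R (n / 2))
    refine not_mlr_of_constraints (computable_nSeq q 0 h0 hq) (Computable.const false)
      (nSeq_injective q 0 h0) hY (hred X (mem_either_of_odd hR fun k => ?_))
    rw [hX _ (by omega)]
    congr 1; omega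
  simp only [hasBig_iff] at h0 h1
  push Not at h0 h1
  obtain ⟨s, hs⟩ := h0
  obtain ⟨t, ht⟩ := h1
  have hbd : ∀ n, ∀ i ∈ q n, i < s + t := by
    intro n i hi
    have a1 := hs n i hi
    have a2 := ht n i hi
    by_contra hc
    have := a1 (by omega)
    have := a2 (by omega)
    omega
  have hX : join R R ∈ Either MLR := ⟨R, R, rfl, Or.inl hR⟩
  exact not_mlr_of_constraints Computable.id (computable_linEval_bounded hq hb _ hbd (join R R))
    Function.injective_id (fun _ => rfl) (hred _ hX)
end

section
/- For every k ≥ 1, MLR is truth-table Medvedev reducible to Some(MLR, k): there exists a truth-table reduction Φ such that Φ^X ∈ MLR for every X ∈ Some(MLR, k). -/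
open MeasureTheory

/-- The `i`-th of `k` interleaved columns of `X`: `X_i(n) = X(k·n + i)`. -/
def colK (k : ℕ) (X : Cantor) (i : ℕ) : Cantor := fun n => X (k * n + i)

/-- `Some(C, k)`: some column `i < k` is in `C`. -/
def SomeK (C : Set Cantor) (k : ℕ) : Set Cantor := {X | ∃ i < k, colK k X i ∈ C}

/-- The natural number with the given (little-endian) list of bits. -/
def bitsToNat : List Bool → ℕ
  | [] => 0
  | b :: l => (cond b 1 0) + 2 * bitsToNat l

/-- A truth-table reduction, given by query positions `q n` and a truth table `t n`
with one entry for each of the `2^{|q n|}` possible bit-vectors of answers;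
the pair must be computable (as a function of `n`), uniformly. -/
def TTReduction (q : ℕ → List ℕ) (t : ℕ → List Bool) : Prop :=
  Computable (fun n => (q n, t n)) ∧ ∀ n, (t n).length = 2 ^ (q n).length

/-- The output `Φ^X` of the truth-table reduction given by `(q, t)` on oracle `X`:
bit `n` is the entry of `t n` indexed by the bit-vector of oracle answers. -/
def ttEval (q : ℕ → List ℕ) (t : ℕ → List Bool) (X : Cantor) : Cantor :=
  fun n => (t n).getD (bitsToNat ((q n).map X)) false


/-! ### Measure of cylinders -/

lemma measurable_digits :
    Measurable (fun (x : ℝ) (n : ℕ) => decide ((⌊x * 2 ^ (n + 1)⌋ % 2 : ℤ) = 1)) := by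
  rw [measurable_pi_iff]
  intro n
  have h1 : Measurable (fun x : ℝ => ⌊x * 2 ^ (n + 1)⌋) :=
    Int.measurable_floor.comp (measurable_id.mul_const _)
  exact (Measurable.of_discrete (f := fun z : ℤ => decide (z % 2 = 1))).comp h1

lemma cylinder_append (σ : List Bool) (b : Bool) :
    cylinder (σ ++ [b]) = {X | X ∈ cylinder σ ∧ X σ.length = b} := by
  ext X
  simp only [_root_.cylinder, Set.mem_ofPred_eq, List.get_eq_getElem]
  constructor
  · intro h
    refine ⟨fun i hi => ?_, ?_⟩
    · have := h i (by simp; omega)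
      rwa [List.getElem_append_left hi] at this
    · have := h σ.length (by simp)
      simpa using this
  · rintro ⟨h1, h2⟩ i hi
    by_cases hlt : i < σ.length
    · rw [List.getElem_append_left hlt]; exact h1 i hlt
    · have : i = σ.length := by simp at hi; omega
      subst this
      simpa using h2

lemma digits_cylinder (σ : List Bool) : ∃ j : ℤ, ∀ x : ℝ,
    ((fun n : ℕ => decide ((⌊x * 2 ^ (n + 1)⌋ % 2 : ℤ) = 1)) ∈ cylinder σ ∧ x ∈ Set.Ico (0 : ℝ) 1)
      ↔ ⌊x * 2 ^ σ.length⌋ = j := by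
  induction σ using List.reverseRecOn with
  | nil =>
    refine ⟨0, fun x => ?_⟩
    simp [_root_.cylinder, Int.floor_eq_iff]
  | append_singleton σ b ih =>
    obtain ⟨j, hj⟩ := ih
    refine ⟨2 * j + (cond b 1 0), fun x => ?_⟩
    rw [cylinder_append, Set.mem_ofPred_eq, and_right_comm, hj x]
    simp only [List.length_append, List.length_singleton]
    have e : x * 2 ^ (σ.length + 1) = 2 * (x * 2 ^ σ.length) := by ring
    rw [e]
    generalize x * 2 ^ σ.length = y
    have h1 := Int.floor_le y
    have h2 := Int.lt_floor_add_one y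
    have h3 : 2 * ⌊y⌋ ≤ ⌊2 * y⌋ := by
      rw [Int.le_floor]; push_cast; linarith
    have h4 : ⌊2 * y⌋ < 2 * ⌊y⌋ + 2 := by
      rw [Int.floor_lt]; push_cast; linarith
    cases b
    · simp only [decide_eq_false_iff_not, cond_false]; omega
    · simp only [decide_eq_true_eq, cond_true]; omega

lemma measurableSet_cylinder (σ : List Bool) : MeasurableSet (cylinder σ) := by
  have : cylinder σ = ⋂ i : ℕ, ⋂ h : i < σ.length, (fun X : Cantor => X i) ⁻¹' {σ.get ⟨i, h⟩} := by
    ext X; simp [_root_.cylinder]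
  rw [this]
  exact MeasurableSet.iInter fun i => MeasurableSet.iInter fun h =>
    (measurable_pi_apply i) (measurableSet_singleton _)

lemma fairCoin_cylinder (σ : List Bool) :
    fairCoin (cylinder σ) = ((2 : ENNReal) ^ σ.length)⁻¹ := by
  obtain ⟨j, hj⟩ := digits_cylinder σ
  rw [fairCoin, Measure.map_apply measurable_digits (measurableSet_cylinder σ),
    Measure.restrict_apply (measurable_digits (measurableSet_cylinder σ))]
  have hp : (0 : ℝ) < 2 ^ σ.length := by positivity
  have : ((fun (x : ℝ) (n : ℕ) => decide ((⌊x * 2 ^ (n + 1)⌋ % 2 : ℤ) = 1)) ⁻¹' cylinder σ)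
      ∩ Set.Ico (0 : ℝ) 1 = Set.Ico ((j : ℝ) / 2 ^ σ.length) ((j + 1 : ℝ) / 2 ^ σ.length) := by
    ext x
    rw [Set.mem_inter_iff, Set.mem_preimage, hj x, Int.floor_eq_iff, Set.mem_Ico,
      div_le_iff₀ hp, lt_div_iff₀ hp]
  rw [this, Real.volume_Ico]
  have e : (j + 1 : ℝ) / 2 ^ σ.length - j / 2 ^ σ.length = (2 ^ σ.length)⁻¹ := by
    field_simp; ring
  rw [e, ENNReal.ofReal_inv_of_pos hp, ENNReal.ofReal_pow (by norm_num)]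
  simp

instance : IsFiniteMeasure fairCoin := by
  constructor
  have h := fairCoin_cylinder []
  have : cylinder [] = Set.univ := by ext; simp [_root_.cylinder]
  rw [this] at h
  rw [h]; simp

/-! ### Prefixes -/

/-- The prefix of `X` of length `L`. -/
def pfx (X : Cantor) (L : ℕ) : List Bool := (List.range L).map X

lemma length_pfx (X : Cantor) (L : ℕ) : (pfx X L).length = L := by simp [pfx]

lemma mem_cylinder_iff (X : Cantor) (σ : List Bool) : X ∈ cylinder σ ↔ pfx X σ.length = σ := by
  constructor
  · intro h
    apply List.ext_getElem (by simp [pfx])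
    intro i h1 h2
    simpa [pfx] using h i h2
  · intro h i hi
    have : (pfx X σ.length)[i]'(by simp [pfx, hi]) = σ[i] := by simp only [h]
    simpa [pfx] using this

lemma take_pfx (X : Cantor) {l L : ℕ} (h : l ≤ L) : (pfx X L).take l = pfx X l := by
  simp [pfx, ← List.map_take, List.take_range, h]

lemma take_pfx_eq_iff (X : Cantor) (σ : List Bool) (L : ℕ) :
    (pfx X L).take σ.length = σ ↔ σ.length ≤ L ∧ X ∈ cylinder σ := by
  constructor
  · intro h
    have h' : σ.length ≤ L := by
      have := congrArg List.length h
      simp [pfx] at this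
      exact this
    rw [take_pfx X h'] at h
    exact ⟨h', (mem_cylinder_iff _ _).2 h⟩
  · rintro ⟨h1, h2⟩
    rw [take_pfx X h1]
    exact (mem_cylinder_iff _ _).1 h2

lemma cylinder_disj {σ τ : List Bool} (hl : σ.length = τ.length) (hne : σ ≠ τ) :
    Disjoint (cylinder σ) (cylinder τ) := by
  rw [Set.disjoint_left]
  intro X h1 h2
  rw [mem_cylinder_iff] at h1 h2
  exact hne (by rw [← h1, ← h2, hl])

/-! ### Invariance of the measure under coordinatewise xor -/

lemma measure_ext_cylinder (ν : Measure Cantor)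
    (h : ∀ σ, fairCoin (cylinder σ) = ν (cylinder σ)) : fairCoin = ν := by
  have hu : cylinder [] = Set.univ := by ext; simp [_root_.cylinder]
  refine ext_of_generate_finite (insert ∅ (Set.range cylinder)) ?_ ?_ ?_ ?_
  · apply le_antisymm
    · refine iSup_le fun i => ?_
      rw [← measurable_iff_comap_le]
      refine @measurable_to_bool _ (MeasurableSpace.generateFrom _) _ ?_
      have : (fun X : Cantor => X i) ⁻¹' {true} =
          ⋃ τ : {τ : List Bool // τ.length = i + 1 ∧ τ.getD i false = true}, cylinder τ.1 := by
        ext X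
        simp only [Set.mem_preimage, Set.mem_singleton_iff, Set.mem_iUnion]
        constructor
        · intro hX
          refine ⟨⟨pfx X (i+1), length_pfx _ _, by simp [pfx, hX]⟩, ?_⟩
          exact (mem_cylinder_iff _ _).2 (congrArg (pfx X) (length_pfx X (i+1)))
        · rintro ⟨⟨τ, h1, h2⟩, h3⟩
          have := h3 i (show i < τ.length by omega)
          rw [this]
          rw [List.getD_eq_getElem _ _ (by omega)] at h2
          simpa using h2
      rw [this]
      refine @MeasurableSet.iUnion _ _ (MeasurableSpace.generateFrom _) _ _ fun τ => ?_
      exact MeasurableSpace.measurableSet_generateFrom (Or.inr ⟨_, rfl⟩)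
    · refine MeasurableSpace.generateFrom_le ?_
      rintro t (rfl | ⟨σ, rfl⟩)
      · exact MeasurableSet.empty
      · exact measurableSet_cylinder σ
  · have key : ∀ σ τ : List Bool, σ.length ≤ τ.length → (cylinder σ ∩ cylinder τ).Nonempty →
        cylinder σ ∩ cylinder τ = cylinder τ := by
      rintro σ τ hl ⟨Y, h1, h2⟩
      apply Set.inter_eq_right.2
      intro X hX
      rw [mem_cylinder_iff] at *
      rw [← h1, length_pfx, ← take_pfx X hl, hX, ← h2, take_pfx Y hl]
    rintro s (rfl | ⟨σ, rfl⟩) t (rfl | ⟨τ, rfl⟩) hne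
    · simp at hne
    · simp at hne
    · simp at hne
    · right
      rcases le_total σ.length τ.length with hl | hl
      · exact ⟨τ, (key σ τ hl hne).symm⟩
      · refine ⟨σ, ?_⟩
        rw [Set.inter_comm] at hne ⊢
        exact (key τ σ hl hne).symm
  · rintro t (rfl | ⟨σ, rfl⟩)
    · simp
    · exact h σ
  · rw [← hu]; exact h []

/-- Coordinatewise xor of a string with (the zero-extension of) `L`. -/
def xorStr (L σ : List Bool) : List Bool :=
  (List.range σ.length).map (fun i => xor (σ.getD i false) (L.getD i false))

/-- Coordinatewise xor of a real with (the zero-extension of) `L`. -/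
def xorReal (L : List Bool) (X : Cantor) : Cantor := fun i => xor (X i) (L.getD i false)

lemma length_xorStr (L σ : List Bool) : (xorStr L σ).length = σ.length := by simp [xorStr]

lemma xorReal_mem (L σ : List Bool) (X : Cantor) :
    xorReal L X ∈ cylinder σ ↔ X ∈ cylinder (xorStr L σ) := by
  simp only [_root_.cylinder, Set.mem_ofPred_eq, xorReal, List.get_eq_getElem, length_xorStr]
  refine forall_congr' fun i => forall_congr' fun h => ?_
  simp only [xorStr, List.getElem_map, List.getElem_range, List.getD_eq_getElem σ _ h]
  generalize σ[i] = a
  generalize L.getD i false = b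
  generalize X i = c
  revert a b c; decide

lemma measurable_xorReal (L : List Bool) : Measurable (xorReal L) := by
  rw [measurable_pi_iff]
  intro i
  exact (Measurable.of_discrete (f := fun b : Bool => xor b (L.getD i false))).comp
    (measurable_pi_apply i)

lemma map_xorReal (L : List Bool) : fairCoin = fairCoin.map (xorReal L) := by
  apply measure_ext_cylinder
  intro σ
  rw [Measure.map_apply (measurable_xorReal L) (measurableSet_cylinder σ)]
  have : xorReal L ⁻¹' cylinder σ = cylinder (xorStr L σ) := by
    ext X; exact xorReal_mem L σ X
  rw [this, fairCoin_cylinder, fairCoin_cylinder, length_xorStr]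

lemma measurableSet_testSet (U : ℕ → ℕ → Option (List Bool)) (n : ℕ) :
    MeasurableSet (testSet U n) :=
  MeasurableSet.biUnion (Set.to_countable _) fun σ _ => measurableSet_cylinder σ

lemma mem_testSet (U : ℕ → ℕ → Option (List Bool)) (n : ℕ) (X : Cantor) :
    X ∈ testSet U n ↔ ∃ k σ, U n k = some σ ∧ X ∈ cylinder σ := by
  simp only [testSet, Set.mem_iUnion, Set.mem_ofPred_eq, exists_prop]
  constructor
  · rintro ⟨σ, ⟨k, h⟩, h2⟩; exact ⟨k, σ, h, h2⟩
  · rintro ⟨k, σ, h, h2⟩; exact ⟨σ, ⟨k, h⟩, h2⟩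

lemma primrec_xorStr (L : List Bool) : Primrec (xorStr L) := by
  refine Primrec.list_map (Primrec.list_range.comp Primrec.list_length) ?_
  refine (Primrec.dom_bool₂ xor).comp ?_ ?_
  · exact (Primrec.list_getD false).comp Primrec.fst Primrec.snd
  · exact (Primrec.list_getD false).comp (Primrec.const L) Primrec.snd

lemma xorReal_mem_MLR (L : List Bool) (X : Cantor) (hX : X ∈ MLR) : xorReal L X ∈ MLR := by
  intro U hU
  have hmem : ∀ n Y, Y ∈ testSet (fun n k => (U n k).map (xorStr L)) n ↔
      xorReal L Y ∈ testSet U n := by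
    intro n Y
    rw [mem_testSet, mem_testSet]
    constructor
    · rintro ⟨k, σ, h1, h2⟩
      obtain ⟨τ, h3, rfl⟩ := Option.map_eq_some_iff.1 h1
      exact ⟨k, τ, h3, (xorReal_mem _ _ _).2 h2⟩
    · rintro ⟨k, σ, h1, h2⟩
      exact ⟨k, xorStr L σ, by simp [h1], (xorReal_mem _ _ _).1 h2⟩
  suffices hT : MLTest (fun n k => (U n k).map (xorStr L)) by
    obtain ⟨n, hn⟩ := hX _ hT
    exact ⟨n, fun h => hn ((hmem n X).2 h)⟩
  constructor
  · exact Computable.option_map hU.1 ((primrec_xorStr L).to_comp.comp Computable.snd).to₂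
  · intro n
    have : testSet (fun n k => (U n k).map (xorStr L)) n = xorReal L ⁻¹' testSet U n := by
      ext Y; exact hmem n Y
    rw [this, ← Measure.map_apply (measurable_xorReal L) (measurableSet_testSet U n),
      ← map_xorReal]
    exact hU.2 n

lemma MLR_of_eventually_eq {X Y : Cantor} (hX : X ∈ MLR) (N : ℕ) (h : ∀ n ≥ N, Y n = X n) :
    Y ∈ MLR := by
  have : Y = xorReal ((List.range N).map fun i => xor (X i) (Y i)) X := by
    funext i
    simp only [xorReal]
    by_cases hi : i < N
    · rw [List.getD_eq_getElem _ _ (by simpa using hi)]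
      simp
    · rw [List.getD_eq_default _ _ (by simpa using hi), h i (by omega)]
      simp
  rw [this]
  exact xorReal_mem_MLR _ _ hX

/-! ### Bit strings coded by numbers -/

/-- The little-endian bit string of length `L` of the number `j`. -/
def natBits (L j : ℕ) : List Bool := (List.range L).map (fun i => decide (j / 2 ^ i % 2 = 1))

lemma length_natBits (L j : ℕ) : (natBits L j).length = L := by simp [natBits]

lemma natBits_succ (L j : ℕ) : natBits (L + 1) j = decide (j % 2 = 1) :: natBits L (j / 2) := by
  simp only [natBits, List.range_succ_eq_map, List.map_cons, List.map_map]
  congr 1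
  · simp
  · apply List.map_congr_left
    intro i _
    simp [Nat.pow_succ', Nat.div_div_eq_div_mul]

lemma natBits_bitsToNat (l : List Bool) : natBits l.length (bitsToNat l) = l := by
  induction l with
  | nil => simp [natBits]
  | cons b l ih =>
    rw [List.length_cons, natBits_succ]
    cases b
    · simp [bitsToNat, ih]
    · have h1 : (1 + 2 * bitsToNat l) % 2 = 1 := by omega
      have h2 : (1 + 2 * bitsToNat l) / 2 = bitsToNat l := by omega
      simp [bitsToNat, ih, h1, h2]

lemma bitsToNat_lt (l : List Bool) : bitsToNat l < 2 ^ l.length := by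
  induction l with
  | nil => simp [bitsToNat]
  | cons b l ih =>
    rw [List.length_cons, pow_succ]
    cases b <;> simp [bitsToNat] <;> omega

lemma natBits_inj {L i j : ℕ} (hi : i < 2 ^ L) (hj : j < 2 ^ L) (h : natBits L i = natBits L j) :
    i = j := by
  induction L generalizing i j with
  | zero => simp at hi hj; omega
  | succ L ih =>
    rw [natBits_succ, natBits_succ, List.cons.injEq] at h
    rw [pow_succ] at hi hj
    have h2 := ih (by omega) (by omega) h.2
    have h1 := h.1
    rw [decide_eq_decide] at h1
    omega

lemma primrec_pow : Primrec₂ ((· ^ ·) : ℕ → ℕ → ℕ) :=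
  Primrec₂.unpaired'.1 Nat.Primrec.pow

lemma primrec_natBits : Primrec₂ natBits := by
  refine Primrec.list_map (Primrec.list_range.comp Primrec.fst) ?_
  refine PrimrecPred.decide (p := fun x : (ℕ × ℕ) × ℕ => x.1.2 / 2 ^ x.2 % 2 = 1) ?_
  refine Primrec.eq.comp (Primrec.nat_mod.comp (Primrec.nat_div.comp
    (Primrec.snd.comp Primrec.fst) (primrec_pow.comp (Primrec.const 2) Primrec.snd))
    (Primrec.const 2)) (Primrec.const 1)

/-! ### The universal test -/

/-- The `k`-th string enumerated at level `n` by the `e`-th program within `s` steps. -/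
def gcode (p : ℕ × ℕ × ℕ) (k : ℕ) : Option (List Bool) :=
  ((Nat.Partrec.Code.evaln p.2.2 (Denumerable.ofNat Nat.Partrec.Code p.1)
    (Nat.pair p.2.1 k)).bind
      (fun v => (Encodable.decode v : Option (Option (List Bool))))).bind id

lemma primrec_gcode : Primrec₂ gcode := by
  refine Primrec.option_bind (Primrec.option_bind ?_ ?_) ?_
  · refine Nat.Partrec.Code.primrec_evaln.comp (Primrec.pair (Primrec.pair ?_ ?_) ?_)
    · exact Primrec.snd.comp (Primrec.snd.comp Primrec.fst)
    · exact (Primrec.ofNat Nat.Partrec.Code).comp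
        (g := fun x : (ℕ × ℕ × ℕ) × ℕ => x.1.1) (Primrec.fst.comp Primrec.fst)
    · exact Primrec₂.natPair.comp (Primrec.fst.comp (Primrec.snd.comp Primrec.fst)) Primrec.snd
  · exact (Primrec.decode.comp Primrec.snd).to₂
  · exact (Primrec.snd : Primrec (Prod.snd : ((ℕ × ℕ × ℕ) × ℕ) × Option (List Bool) → _))

/-- `o` is a string which is a prefix of `τ`. -/
def hits (o : Option (List Bool)) (τ : List Bool) : Bool :=
  Option.casesOn (motive := fun _ => Bool) o false
    (fun σ => decide (τ.take σ.length = σ))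

lemma hits_iff (o : Option (List Bool)) (τ : List Bool) :
    hits o τ = true ↔ ∃ σ, o = some σ ∧ τ.take σ.length = σ := by
  cases o <;> simp [hits]

lemma primrec_hits : Primrec₂ hits := by
  refine Primrec.option_casesOn Primrec.fst (Primrec.const false) ?_
  refine PrimrecPred.decide (p := fun x : (Option (List Bool) × List Bool) × List Bool =>
    x.1.2.take x.2.length = x.2) ?_
  exact Primrec.eq.comp (Primrec.list_take.comp (Primrec.list_length.comp Primrec.snd)
    (Primrec.snd.comp Primrec.fst)) Primrec.snd

/-- `τ` is covered by the first `s` strings of program `e` at level `n`. -/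
def cov (p : ℕ × ℕ × ℕ) (τ : List Bool) : Prop :=
  ∃ k ∈ List.range p.2.2, hits (gcode p k) τ = true

instance (p : ℕ × ℕ × ℕ) (τ : List Bool) : Decidable (cov p τ) := by
  unfold cov; infer_instance

lemma primrec_cov : PrimrecRel cov := by
  have h : PrimrecRel (fun (k : ℕ) (y : (ℕ × ℕ × ℕ) × List Bool) =>
      hits (gcode y.1 k) y.2 = true) := by
    refine Primrec.eq.comp (primrec_hits.comp (primrec_gcode.comp ?_ Primrec.fst) ?_)
      (Primrec.const true)
    · exact Primrec.fst.comp Primrec.snd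
    · exact Primrec.snd.comp Primrec.snd
  exact h.exists_mem_list.comp
    (Primrec.list_range.comp (Primrec.snd.comp (Primrec.snd.comp Primrec.fst))) Primrec.id

/-- Number of strings of length `s` which are covered. -/
def cnt (p : ℕ × ℕ × ℕ) : ℕ :=
  ((List.range (2 ^ p.2.2)).filter (fun t => decide (cov p (natBits p.2.2 t)))).length

lemma primrec_cnt : Primrec cnt := by
  have h : PrimrecRel (fun (t : ℕ) (p : ℕ × ℕ × ℕ) => cov p (natBits p.2.2 t)) := by
    refine primrec_cov.comp Primrec.snd (primrec_natBits.comp ?_ Primrec.fst)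
    exact Primrec.snd.comp (Primrec.snd.comp Primrec.snd)
  refine Primrec.list_length.comp (h.listFilter.comp (Primrec.list_range.comp
    (primrec_pow.comp (Primrec.const 2) ?_)) Primrec.id)
  exact Primrec.snd.comp Primrec.snd

/-- The measure of the part covered so far is at most `2^{-n}`. -/
def okk (p : ℕ × ℕ × ℕ) : Prop := cnt p * 2 ^ p.2.1 ≤ 2 ^ p.2.2

instance : DecidablePred okk := fun p => by unfold okk; infer_instance

lemma primrec_okk : PrimrecPred okk := by
  refine Primrec.nat_le.comp (Primrec.nat_mul.comp primrec_cnt (primrec_pow.comp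
    (Primrec.const 2) ?_)) (primrec_pow.comp (Primrec.const 2) ?_)
  · exact Primrec.fst.comp Primrec.snd
  · exact Primrec.snd.comp Primrec.snd

/-- The open set covered so far. -/
def wset (p : ℕ × ℕ × ℕ) : Set Cantor := {X | cov p (pfx X p.2.2)}

lemma wset_eq (p : ℕ × ℕ × ℕ) : wset p =
    ⋃ t ∈ (Finset.range (2 ^ p.2.2)).filter (fun t => cov p (natBits p.2.2 t)),
      cylinder (natBits p.2.2 t) := by
  ext X
  simp only [wset, Set.mem_ofPred_eq, Set.mem_iUnion, Finset.mem_filter, Finset.mem_range,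
    exists_prop]
  constructor
  · intro h
    have e : natBits p.2.2 (bitsToNat (pfx X p.2.2)) = pfx X p.2.2 := by
      have := natBits_bitsToNat (pfx X p.2.2)
      rwa [length_pfx] at this
    refine ⟨bitsToNat (pfx X p.2.2), ⟨?_, ?_⟩, ?_⟩
    · have := bitsToNat_lt (pfx X p.2.2)
      rwa [length_pfx] at this
    · rwa [e]
    · rw [e, mem_cylinder_iff, length_pfx]
  · rintro ⟨t, ⟨_, h2⟩, h3⟩
    rw [mem_cylinder_iff, length_natBits] at h3
    rwa [h3]

lemma measure_wset (p : ℕ × ℕ × ℕ) :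
    fairCoin (wset p) = (cnt p : ENNReal) * ((2 : ENNReal) ^ p.2.2)⁻¹ := by
  rw [wset_eq, measure_biUnion_finset]
  · simp only [fairCoin_cylinder, length_natBits, Finset.sum_const, nsmul_eq_mul]
    congr 2
  · intro i hi j hj hij
    simp only [Finset.coe_filter, Finset.mem_range, Set.mem_ofPred_eq] at hi hj
    refine cylinder_disj (by rw [length_natBits, length_natBits]) fun h => hij ?_
    exact natBits_inj hi.1 hj.1 h
  · intro t _
    exact measurableSet_cylinder _

lemma okk_iff (p : ℕ × ℕ × ℕ) : okk p ↔ fairCoin (wset p) ≤ ((2 : ENNReal) ^ p.2.1)⁻¹ := by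
  rw [measure_wset, okk, ← div_eq_mul_inv,
    ENNReal.div_le_iff_le_mul (Or.inl (by simp)) (Or.inl (by simp)), mul_comm (_⁻¹), ← div_eq_mul_inv,
    ENNReal.le_div_iff_mul_le (Or.inl (by simp)) (Or.inl (by simp))]
  exact_mod_cast Iff.rfl

lemma mem_wset (p : ℕ × ℕ × ℕ) (X : Cantor) : X ∈ wset p ↔
    ∃ k σ, gcode p k = some σ ∧ σ.length ≤ p.2.2 ∧ X ∈ cylinder σ := by
  simp only [wset, Set.mem_ofPred_eq, cov, hits_iff, take_pfx_eq_iff]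
  constructor
  · rintro ⟨k, _, σ, h⟩
    exact ⟨k, σ, h⟩
  · rintro ⟨k, σ, h, h'⟩
    refine ⟨k, ?_, σ, h, h'⟩
    rw [List.mem_range]
    rw [gcode, Option.bind_eq_some_iff] at h
    obtain ⟨a, h, -⟩ := h
    rw [Option.bind_eq_some_iff] at h
    obtain ⟨v, h, -⟩ := h
    have := Nat.Partrec.Code.evaln_bound (Option.mem_def.2 h)
    exact lt_of_le_of_lt (Nat.right_le_pair _ _) this

lemma gcode_mono {e n s s' k : ℕ} (hs : s ≤ s') {σ : List Bool}
    (h : gcode (e, n, s) k = some σ) : gcode (e, n, s') k = some σ := by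
  simp only [gcode, Option.bind_eq_some_iff] at h ⊢
  obtain ⟨a, ⟨v, h1, h2⟩, h3⟩ := h
  exact ⟨a, ⟨v, Nat.Partrec.Code.evaln_mono hs h1, h2⟩, h3⟩

lemma wset_mono (e n : ℕ) {s s' : ℕ} (hs : s ≤ s') : wset (e, n, s) ⊆ wset (e, n, s') := by
  intro X hX
  rw [mem_wset] at *
  obtain ⟨k, σ, h1, h2, h3⟩ := hX
  exact ⟨k, σ, gcode_mono hs h1, le_trans h2 hs, h3⟩

/-- Parameters of the `j`-th string of level `m` of the universal test. -/
def upar (m j : ℕ) : ℕ × ℕ × ℕ :=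
  (j.unpair.1, m + j.unpair.1 + 1, j.unpair.2.unpair.1)

/-- The universal test; only strings no longer than the stage are enumerated. -/
def univ (m j : ℕ) : Option (List Bool) :=
  if okk (upar m j) then
    (gcode (upar m j) j.unpair.2.unpair.2).bind
      (fun σ => if σ.length ≤ (upar m j).2.2 then some σ else none)
  else none

lemma primrec_upar : Primrec₂ upar := by
  have h1 : Primrec (fun x : ℕ × ℕ => x.2.unpair.1) :=
    Primrec.fst.comp (Primrec.unpair.comp Primrec.snd)
  have h2 : Primrec (fun x : ℕ × ℕ => x.2.unpair.2.unpair.1) :=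
    Primrec.fst.comp (Primrec.unpair.comp (Primrec.snd.comp (Primrec.unpair.comp Primrec.snd)))
  exact h1.pair ((Primrec.succ.comp (Primrec.nat_add.comp Primrec.fst h1)).pair h2)

lemma primrec_univ : Primrec₂ univ := by
  refine Primrec.ite (primrec_okk.comp primrec_upar) ?_ (Primrec.const none)
  refine Primrec.option_bind (primrec_gcode.comp primrec_upar ?_) ?_
  · exact Primrec.snd.comp (Primrec.unpair.comp (Primrec.snd.comp (Primrec.unpair.comp
      Primrec.snd)))
  · refine Primrec.ite (Primrec.nat_le.comp (Primrec.list_length.comp Primrec.snd) ?_)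
      (Primrec.option_some.comp Primrec.snd) (Primrec.const none)
    exact Primrec.snd.comp (Primrec.snd.comp (primrec_upar.comp (Primrec.fst.comp Primrec.fst)
      (Primrec.snd.comp Primrec.fst)))

lemma testSet_univ (m : ℕ) : testSet univ m =
    ⋃ e : ℕ, ⋃ s ∈ {s | okk (e, m + e + 1, s)}, wset (e, m + e + 1, s) := by
  ext X
  simp only [mem_testSet, Set.mem_iUnion, Set.mem_ofPred_eq, exists_prop, mem_wset]
  constructor
  · rintro ⟨j, σ, h1, h2⟩
    unfold univ at h1
    split_ifs at h1 with hok
    rw [Option.bind_eq_some_iff] at h1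
    obtain ⟨τ, h3, h4⟩ := h1
    split_ifs at h4 with hl
    obtain rfl := Option.some.inj h4
    exact ⟨j.unpair.1, j.unpair.2.unpair.1, hok, _, τ, h3, hl, h2⟩
  · rintro ⟨e, s, hok, k, σ, h1, h2, h3⟩
    refine ⟨Nat.pair e (Nat.pair s k), σ, ?_, h3⟩
    have hu : upar m (Nat.pair e (Nat.pair s k)) = (e, m + e + 1, s) := by simp [upar]
    unfold univ
    rw [hu, if_pos hok]
    simp only [Nat.unpair_pair]
    rw [h1]
    simpa using h2

lemma MLTest_univ : MLTest univ := by
  refine ⟨primrec_univ.to_comp, fun m => ?_⟩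
  rw [testSet_univ]
  refine (measure_iUnion_le _).trans ?_
  have h : ∀ e, fairCoin (⋃ s ∈ {s | okk (e, m + e + 1, s)}, wset (e, m + e + 1, s)) ≤
      ((2 : ENNReal) ^ m)⁻¹ * (2⁻¹ ^ (e + 1)) := by
    intro e
    rw [measure_biUnion_eq_iSup (Set.to_countable _)]
    · refine iSup₂_le fun s hs => ((okk_iff _).1 hs).trans (le_of_eq ?_)
      show ((2 : ENNReal) ^ (m + e + 1))⁻¹ = _
      rw [add_assoc, pow_add, ENNReal.mul_inv (by simp) (by simp), ENNReal.inv_pow,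
        ENNReal.inv_pow]
    · intro s hs t ht
      rcases le_total s t with h | h
      · exact ⟨t, ht, wset_mono _ _ h, subset_rfl⟩
      · exact ⟨s, hs, subset_rfl, wset_mono _ _ h⟩
  refine (ENNReal.tsum_le_tsum h).trans ?_
  rw [ENNReal.tsum_mul_left, ENNReal.tsum_geometric_add_one]
  simp [ENNReal.one_sub_inv_two, ENNReal.inv_mul_cancel]

lemma MLR_of_notMem_univ {X : Cantor} {m : ℕ} (h : X ∉ testSet univ m) : X ∈ MLR := by
  intro U hU
  have h1 : Computable (fun x : ℕ => U x.unpair.1 x.unpair.2) :=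
    hU.1.comp (Computable.fst.comp Computable.unpair) (Computable.snd.comp Computable.unpair)
  have h2 : Computable (fun x : ℕ => Encodable.encode (U x.unpair.1 x.unpair.2)) :=
    Computable.encode.comp h1
  obtain ⟨c, hc⟩ := Nat.Partrec.Code.exists_code.1 (Partrec.nat_iff.1 h2)
  have hev : ∀ n k, Encodable.encode (U n k) ∈ Nat.Partrec.Code.eval c (Nat.pair n k) := by
    intro n k
    rw [hc]
    simp
  set e := Encodable.encode c with he
  set n := m + e + 1 with hn
  have hof : Denumerable.ofNat Nat.Partrec.Code e = c := by simp [he]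
  have hg : ∀ s k σ, gcode (e, n, s) k = some σ → U n k = some σ := by
    intro s k σ hs
    simp only [gcode, Option.bind_eq_some_iff, hof] at hs
    obtain ⟨a, ⟨v, h1, h2⟩, h3⟩ := hs
    have := Part.mem_unique (Nat.Partrec.Code.evaln_sound (Option.mem_def.2 h1)) (hev n k)
    rw [this, Encodable.encodek] at h2
    rw [Option.some.inj h2]
    exact h3
  refine ⟨n, fun hX => h ?_⟩
  rw [testSet_univ]
  rw [mem_testSet] at hX
  obtain ⟨k, σ, hk, hX⟩ := hX
  obtain ⟨s, hs⟩ := Nat.Partrec.Code.evaln_complete.1 (hev n k)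
  simp only [Set.mem_iUnion, Set.mem_ofPred_eq, exists_prop]
  refine ⟨e, max s σ.length, ?_, ?_⟩
  · rw [okk_iff]
    refine le_trans (measure_mono ?_) (hU.2 n)
    intro Y hY
    rw [mem_wset] at hY
    obtain ⟨k', τ, h3, _, h4⟩ := hY
    rw [mem_testSet]
    exact ⟨k', τ, hg _ _ _ h3, h4⟩
  · rw [mem_wset]
    refine ⟨k, σ, ?_, le_max_right _ _, hX⟩
    refine gcode_mono (le_max_left _ _) ?_
    simp only [gcode, Option.bind_eq_some_iff, hof]
    exact ⟨U n k, ⟨_, hs, by rw [Encodable.encodek]⟩, hk⟩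

/-! ### The reduction -/

/-- At stage `n`, the string `τ` has been covered by level `m` of the universal test. -/
def caught (m n : ℕ) (τ : List Bool) : Prop := ∃ j ∈ List.range n, hits (univ m j) τ = true

instance (m n : ℕ) (τ : List Bool) : Decidable (caught m n τ) := by
  unfold caught; infer_instance

lemma primrec_caught : PrimrecPred (fun x : ℕ × ℕ × List Bool => caught x.1 x.2.1 x.2.2) := by
  have h : PrimrecRel (fun (j : ℕ) (x : ℕ × ℕ × List Bool) =>
      hits (univ x.1 j) x.2.2 = true) := by
    refine Primrec.eq.comp (primrec_hits.comp (primrec_univ.comp ?_ Primrec.fst) ?_)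
      (Primrec.const true)
    · exact Primrec.fst.comp Primrec.snd
    · exact Primrec.snd.comp (Primrec.snd.comp Primrec.snd)
  exact h.exists_mem_list.comp
    (Primrec.list_range.comp (Primrec.fst.comp Primrec.snd)) Primrec.id

lemma caught_iff (m n : ℕ) (X : Cantor) : caught m n (pfx X n) ↔
    ∃ j < n, ∃ σ, univ m j = some σ ∧ σ.length ≤ n ∧ X ∈ cylinder σ := by
  simp only [caught, List.mem_range, hits_iff, take_pfx_eq_iff]

/-- The prefix of length `n` of the `i`-th column coded in the string `l`. -/
def colPfx (k : ℕ) (x : (ℕ × List Bool) × ℕ) : List Bool :=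
  (List.range x.1.1).map (fun m => x.1.2.getD (k * m + x.2) false)

lemma primrec_colPfx (k : ℕ) : Primrec (colPfx k) := by
  refine Primrec.list_map (Primrec.list_range.comp (Primrec.fst.comp Primrec.fst)) ?_
  refine (Primrec.list_getD false).comp (Primrec.snd.comp (Primrec.fst.comp Primrec.fst)) ?_
  exact Primrec.nat_add.comp (Primrec.nat_mul.comp (Primrec.const k) Primrec.snd)
    (Primrec.snd.comp Primrec.fst)

/-- The least pair (level, column), coded as `level * k + column`, not yet caught. -/
def sel (k : ℕ) (x : ℕ × List Bool) : ℕ :=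
  (List.range x.1).findIdx (fun p => decide (¬ caught (p / k) x.1 (colPfx k (x, p % k))))

lemma primrec_sel (k : ℕ) : Primrec (sel k) := by
  refine Primrec.list_findIdx (Primrec.list_range.comp Primrec.fst) ?_
  refine PrimrecPred.decide
    (p := fun y : (ℕ × List Bool) × ℕ => ¬ caught (y.2 / k) y.1.1 (colPfx k (y.1, y.2 % k))) ?_
  refine PrimrecPred.not (primrec_caught.comp
    (f := fun y : (ℕ × List Bool) × ℕ => (y.2 / k, y.1.1, colPfx k (y.1, y.2 % k))) ?_)
  refine Primrec.pair (Primrec.nat_div.comp Primrec.snd (Primrec.const k)) (Primrec.pair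
    (Primrec.fst.comp Primrec.fst) ((primrec_colPfx k).comp (Primrec.pair Primrec.fst
      (Primrec.nat_mod.comp Primrec.snd (Primrec.const k)))))

/-- The output bit. -/
def outBit (k : ℕ) (x : ℕ × List Bool) : Bool := x.2.getD (k * x.1 + sel k x % k) false

lemma primrec_outBit (k : ℕ) : Primrec (outBit k) := by
  refine (Primrec.list_getD false).comp Primrec.snd ?_
  exact Primrec.nat_add.comp (Primrec.nat_mul.comp (Primrec.const k) Primrec.fst)
    (Primrec.nat_mod.comp (primrec_sel k) (Primrec.const k))

/-- The queries. -/
def qry (k n : ℕ) : List ℕ := List.range (k * (n + 1))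

/-- The truth table. -/
def tbl (k n : ℕ) : List Bool :=
  (List.range (2 ^ (k * (n + 1)))).map (fun j => outBit k (n, natBits (k * (n + 1)) j))

lemma ttReduction_qry_tbl (k : ℕ) : TTReduction (qry k) (tbl k) := by
  refine ⟨?_, fun n => by simp [qry, tbl]⟩
  have hl : Primrec (fun n : ℕ => k * (n + 1)) :=
    Primrec.nat_mul.comp (Primrec.const k) Primrec.succ
  have h1 : Primrec (qry k) := Primrec.list_range.comp hl
  have h2 : Primrec (tbl k) := by
    refine Primrec.list_map (Primrec.list_range.comp (primrec_pow.comp (Primrec.const 2) hl)) ?_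
    refine (primrec_outBit k).comp (Primrec.pair Primrec.fst (primrec_natBits.comp
      (hl.comp Primrec.fst) Primrec.snd))
  exact (h1.pair h2).to_comp

lemma ttEval_eq (k : ℕ) (X : Cantor) (n : ℕ) :
    ttEval (qry k) (tbl k) X n = outBit k (n, pfx X (k * (n + 1))) := by
  have h1 := bitsToNat_lt (pfx X (k * (n + 1)))
  have h2 := natBits_bitsToNat (pfx X (k * (n + 1)))
  rw [length_pfx] at h1 h2
  show (tbl k n).getD (bitsToNat (pfx X (k * (n + 1)))) false = _
  rw [List.getD_eq_getElem _ _ (by simpa [tbl] using h1)]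
  simp only [tbl, List.getElem_map, List.getElem_range, h2]

lemma getD_pfx (X : Cantor) {i L : ℕ} (h : i < L) : (pfx X L).getD i false = X i := by
  rw [List.getD_eq_getElem _ _ (by simpa [pfx] using h)]
  simp [pfx]

lemma index_lt {k m n i : ℕ} (hi : i < k) (hm : m ≤ n) : k * m + i < k * (n + 1) := by
  have := Nat.mul_le_mul_left k hm
  rw [Nat.mul_succ]; omega

lemma colPfx_pfx (k : ℕ) (X : Cantor) (n i : ℕ) (hi : i < k) :
    colPfx k ((n, pfx X (k * (n + 1))), i) = pfx (colK k X i) n := by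
  unfold colPfx
  rw [pfx]
  apply List.map_congr_left
  intro m hm
  rw [List.mem_range] at hm
  exact getD_pfx X (index_lt hi (by simp at hm; omega))

lemma sel_eventually (k : ℕ) (hk : 1 ≤ k) (X : Cantor) (p : ℕ)
    (hp : colK k X (p % k) ∉ testSet univ (p / k))
    (hlt : ∀ p' < p, colK k X (p' % k) ∈ testSet univ (p' / k)) :
    ∃ N, ∀ n ≥ N, sel k (n, pfx X (k * (n + 1))) = p := by
  have hst : ∀ p', ∃ s, p' < p → ∀ n ≥ s, caught (p' / k) n (pfx (colK k X (p' % k)) n) := by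
    intro p'
    by_cases h : p' < p
    · obtain ⟨j, σ, h1, h2⟩ := (mem_testSet _ _ _).1 (hlt p' h)
      refine ⟨max (j + 1) σ.length, fun _ n hn => ?_⟩
      rw [caught_iff]
      have := le_max_left (j + 1) σ.length
      have := le_max_right (j + 1) σ.length
      exact ⟨j, by omega, σ, h1, by omega, h2⟩
    · exact ⟨0, fun h' => absurd h' h⟩
  choose s hs using hst
  refine ⟨(Finset.range p).sup s + p + 1, fun n hn => ?_⟩
  unfold sel
  have hlen : p < (List.range n).length := by simp; omega
  rw [List.findIdx_eq hlen]
  refine ⟨?_, fun j hj => ?_⟩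
  · simp only [List.getElem_range, decide_eq_true_eq]
    rw [colPfx_pfx k X n _ (Nat.mod_lt _ hk), caught_iff]
    rintro ⟨j, _, σ, h1, _, h2⟩
    exact hp ((mem_testSet _ _ _).2 ⟨j, σ, h1, h2⟩)
  · simp only [List.getElem_range, decide_eq_false_iff_not, not_not]
    rw [colPfx_pfx k X n _ (Nat.mod_lt _ hk)]
    have : s j ≤ (Finset.range p).sup s := Finset.le_sup (by simpa using hj)
    exact hs j hj n (by omega)

/-- For every `k ≥ 1`, MLR is truth-table Medvedev reducible to `Some(MLR, k)`. -/
theorem mlr_le_stt_someK_mlr (k : ℕ) (hk : 1 ≤ k) :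
    ∃ (q : ℕ → List ℕ) (t : ℕ → List Bool), TTReduction q t ∧
      ∀ X ∈ SomeK MLR k, ttEval q t X ∈ MLR := by
  refine ⟨qry k, tbl k, ttReduction_qry_tbl k, fun X hX => ?_⟩
  obtain ⟨i, hi, hXi⟩ := hX
  obtain ⟨m, hm⟩ := hXi univ MLTest_univ
  have hex : ∃ p, colK k X (p % k) ∉ testSet univ (p / k) := by
    refine ⟨k * m + i, ?_⟩
    rw [Nat.mul_add_mod, Nat.mod_eq_of_lt hi, Nat.mul_add_div hk, Nat.div_eq_of_lt hi]
    exact hm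
  classical
  obtain ⟨N, hN⟩ := sel_eventually k hk X (Nat.find hex) (Nat.find_spec hex)
    (fun p' hp' => not_not.1 (Nat.find_min hex hp'))
  refine MLR_of_eventually_eq (MLR_of_notMem_univ (Nat.find_spec hex)) N fun n hn => ?_
  rw [ttEval_eq, outBit, hN n hn]
  exact getD_pfx X (index_lt (Nat.mod_lt _ hk) le_rfl)
end
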